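/- arXiv:2211.16977 — 5 statements merged into one kernel-verified Lean document; each statement's English description precedes it below -/
import Mathlib

section
/- Let L be the Laplacian matrix of a strongly connected weighted digraph on N nodes, let ξ be the positive left eigenvector of L associated with eigenvalue 0 normalized so that ∑_i ξ_i = 1, let R = diag(ξ_1, …, ξ_N), and let L̄ = RL + LᵀR. Then for every vector ς ∈ ℝ^N with all entries strictly positive and every x ∈ ℝ^N with ςᵀx = 0 and x ≠ 0, one has xᵀL̄x > (λ₂(L̄)/N)·xᵀx. -/
open Matrix

def IsAdjacencyMatrix {N : ℕ} (A : Matrix (Fin N) (Fin N) ℝ) : Prop :=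
  (∀ i, A i i = 0) ∧ ∀ i j, 0 ≤ A i j

def IsStronglyConnected {N : ℕ} (A : Matrix (Fin N) (Fin N) ℝ) : Prop :=
  ∀ j i : Fin N, j ≠ i → ∃ (m : ℕ) (k : Fin (m + 1) → Fin N),
    k 0 = j ∧ k (Fin.last m) = i ∧
    ∀ t : Fin m, 0 < A (k t.succ) (k t.castSucc)

def laplacian {N : ℕ} (A : Matrix (Fin N) (Fin N) ℝ) : Matrix (Fin N) (Fin N) ℝ :=
  Matrix.of fun i j => if i = j then ∑ k, A i k else -A i j

/-- The second smallest eigenvalue (eigenvalues listed in nondecreasing order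
with multiplicity) of a real symmetric matrix `M` of size `N ≥ 2`. -/
noncomputable def secondSmallestEigenvalue {N : ℕ} (hN : 2 ≤ N)
    {M : Matrix (Fin N) (Fin N) ℝ} (hM : M.IsHermitian) : ℝ :=
  (hM.eigenvalues ∘ Tuple.sort hM.eigenvalues) ⟨1, by omega⟩

lemma aux_quad {N : ℕ} (A : Matrix (Fin N) (Fin N) ℝ)
    (hA : IsAdjacencyMatrix A) (ξ : Fin N → ℝ)
    (hleft : ξ ᵥ* laplacian A = 0) (x : Fin N → ℝ) :
    x ⬝ᵥ (Matrix.diagonal ξ * laplacian A + (laplacian A)ᵀ * Matrix.diagonal ξ) *ᵥ x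
      = ∑ i, ∑ j, ξ i * A i j * (x i - x j) ^ 2 := by
  have hL : ∀ z : Fin N → ℝ, ∀ i, (laplacian A *ᵥ z) i = ∑ j, A i j * (z i - z j) := by
    intro z i
    have h : ∀ j, laplacian A i j * z j
        = (if i = j then (∑ k, A i k) * z i else 0) - A i j * z j := by
      intro j
      by_cases hij : i = j
      · subst hij; simp [laplacian, hA.1]
      · simp [laplacian, hij]
    simp only [mulVec, dotProduct, h, Finset.sum_sub_distrib, mul_sub, Finset.sum_ite_eq,
      Finset.mem_univ, if_true, Finset.sum_mul]
  have h0 : ∀ z : Fin N → ℝ, ∑ i, ξ i * ∑ j, A i j * (z i - z j) = 0 := by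
    intro z
    have : ξ ⬝ᵥ (laplacian A *ᵥ z) = 0 := by
      rw [dotProduct_mulVec, hleft, zero_dotProduct]
    simpa [dotProduct, hL] using this
  have h1 : x ⬝ᵥ (Matrix.diagonal ξ * laplacian A) *ᵥ x
      = ∑ i, x i * (ξ i * ∑ j, A i j * (x i - x j)) := by
    rw [← mulVec_mulVec]
    simp only [dotProduct, mulVec_diagonal, hL]
  have h2 : x ⬝ᵥ ((laplacian A)ᵀ * Matrix.diagonal ξ) *ᵥ x
      = x ⬝ᵥ (Matrix.diagonal ξ * laplacian A) *ᵥ x := by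
    have : (laplacian A)ᵀ * Matrix.diagonal ξ = (Matrix.diagonal ξ * laplacian A)ᵀ := by
      simp [transpose_mul]
    rw [this, mulVec_transpose, dotProduct_comm, ← dotProduct_mulVec]
  rw [add_mulVec, dotProduct_add, h2, h1]
  have h3 := h0 (fun i => x i ^ 2)
  rw [← sub_zero (_ + _), ← h3, ← Finset.sum_add_distrib, ← Finset.sum_sub_distrib]
  refine Finset.sum_congr rfl fun i _ => ?_
  simp only [Finset.mul_sum]
  rw [← Finset.sum_add_distrib, ← Finset.sum_sub_distrib]
  refine Finset.sum_congr rfl fun j _ => ?_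
  ring

lemma aux_const {N : ℕ} (A : Matrix (Fin N) (Fin N) ℝ)
    (hA : IsAdjacencyMatrix A) (hSC : IsStronglyConnected A)
    (ξ : Fin N → ℝ) (hpos : ∀ i, 0 < ξ i) (x : Fin N → ℝ)
    (h : ∑ i, ∑ j, ξ i * A i j * (x i - x j) ^ 2 ≤ 0) (a b : Fin N) : x a = x b := by
  have hnn : ∀ i j, 0 ≤ ξ i * A i j * (x i - x j) ^ 2 := fun i j =>
    mul_nonneg (mul_nonneg (hpos i).le (hA.2 i j)) (sq_nonneg _)
  have hz : ∀ i j, ξ i * A i j * (x i - x j) ^ 2 = 0 := by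
    have h0 := le_antisymm h (Finset.sum_nonneg fun i _ => Finset.sum_nonneg fun j _ => hnn i j)
    rw [Finset.sum_eq_zero_iff_of_nonneg
      (fun i _ => Finset.sum_nonneg fun j _ => hnn i j)] at h0
    intro i j
    have h1 := h0 i (Finset.mem_univ _)
    rw [Finset.sum_eq_zero_iff_of_nonneg (fun j _ => hnn i j)] at h1
    exact h1 j (Finset.mem_univ _)
  have hedge : ∀ i j, 0 < A i j → x i = x j := by
    intro i j hij
    have := hz i j
    have hne : ξ i * A i j ≠ 0 := (mul_pos (hpos i) hij).ne'
    have h2 := (mul_eq_zero.mp this).resolve_left hne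
    exact sub_eq_zero.mp (pow_eq_zero_iff (two_ne_zero)|>.mp h2)
  by_cases hab : a = b
  · rw [hab]
  obtain ⟨m, k, hk0, hkm, hk⟩ := hSC a b hab
  have : ∀ t : Fin (m + 1), x (k t) = x a := by
    intro t
    induction t using Fin.induction with
    | zero => rw [hk0]
    | succ t ih => rw [hedge _ _ (hk t), ih]
  rw [← hkm, this]

lemma aux_pars {N : ℕ} {M : Matrix (Fin N) (Fin N) ℝ} (hM : M.IsHermitian) (x y : Fin N → ℝ) :
    ∑ i, (x ⬝ᵥ (hM.eigenvectorBasis i).ofLp) * ((hM.eigenvectorBasis i).ofLp ⬝ᵥ y) = x ⬝ᵥ y := by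
  have := hM.eigenvectorBasis.sum_inner_mul_inner (WithLp.toLp 2 x) (WithLp.toLp 2 y)
  simp only [EuclideanSpace.inner_eq_star_dotProduct, star_trivial] at this
  rw [dotProduct_comm x y, ← this]
  refine Finset.sum_congr rfl fun i _ => ?_
  rw [dotProduct_comm x, dotProduct_comm _ y]

lemma aux_orth {N : ℕ} {M : Matrix (Fin N) (Fin N) ℝ} (hM : M.IsHermitian) (i j : Fin N) :
    (hM.eigenvectorBasis i).ofLp ⬝ᵥ (hM.eigenvectorBasis j).ofLp = if i = j then 1 else 0 := by
  have := orthonormal_iff_ite.mp hM.eigenvectorBasis.orthonormal i j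
  simp only [EuclideanSpace.inner_eq_star_dotProduct, star_trivial] at this
  rw [dotProduct_comm, this]

lemma aux_spec {N : ℕ} {M : Matrix (Fin N) (Fin N) ℝ} (hM : M.IsHermitian) (x : Fin N → ℝ) :
    x ⬝ᵥ M *ᵥ x = ∑ i, hM.eigenvalues i * ((hM.eigenvectorBasis i).ofLp ⬝ᵥ x) ^ 2 := by
  rw [← aux_pars hM]
  refine Finset.sum_congr rfl fun i _ => ?_
  have ht : Mᵀ = M := by simpa [conjTranspose_eq_transpose_of_trivial] using hM.eq
  have : (hM.eigenvectorBasis i).ofLp ⬝ᵥ M *ᵥ x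
      = hM.eigenvalues i * ((hM.eigenvectorBasis i).ofLp ⬝ᵥ x) := by
    rw [dotProduct_mulVec, ← mulVec_transpose, ht, hM.mulVec_eigenvectorBasis, smul_dotProduct,
      smul_eq_mul]
  rw [this, dotProduct_comm x]
  ring

lemma aux_cs {N : ℕ} (hN : 2 ≤ N) (ς x : Fin N → ℝ) (hς : ∀ i, 0 < ς i) (hortho : ς ⬝ᵥ x = 0)
    (hx : x ≠ 0) : (∑ i, x i) ^ 2 < (N - 1) * (x ⬝ᵥ x) := by
  have : Nontrivial (Fin N) := Fin.nontrivial_iff_two_le.mpr hN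
  have hq : 0 < x ⬝ᵥ x := by
    have h := dotProduct_star_self_pos_iff (v := x)
    simp only [star_trivial] at h
    exact h.mpr hx
  set P1 := ∑ i, ς i with hP1
  set P2 := ∑ i, ς i ^ 2 with hP2
  have hne : (Finset.univ : Finset (Fin N)).Nonempty := Finset.univ_nonempty
  have hP2pos : 0 < P2 := Finset.sum_pos (fun i _ => pow_pos (hς i) 2) hne
  have hlt : P2 < P1 ^ 2 := by
    rw [sq, hP2]
    conv_rhs => rw [hP1, Finset.sum_mul]
    refine Finset.sum_lt_sum_of_nonempty hne fun i _ => ?_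
    rw [sq]
    refine mul_lt_mul_of_pos_left ?_ (hς i)
    obtain ⟨j, hj⟩ := exists_ne i
    exact Finset.single_lt_sum hj (Finset.mem_univ _) (Finset.mem_univ _) (hς j)
      (fun k _ _ => (hς k).le)
  set t := P1 / P2 with ht
  have hs : ∑ i, x i = ∑ i, (1 - t * ς i) * x i := by
    have : ∑ i, (1 - t * ς i) * x i = ∑ i, x i - t * (ς ⬝ᵥ x) := by
      rw [dotProduct, Finset.mul_sum, ← Finset.sum_sub_distrib]
      exact Finset.sum_congr rfl fun i _ => by ring
    rw [this, hortho]; ring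
  have hn : ∑ i, (1 - t * ς i) ^ 2 = N - P1 ^ 2 / P2 := by
    have : ∑ i, (1 - t * ς i) ^ 2 = N - 2 * t * P1 + t ^ 2 * P2 := by
      rw [hP1, hP2, Finset.mul_sum, Finset.mul_sum]
      have hc : (N : ℝ) = ∑ _i : Fin N, (1 : ℝ) := by simp
      rw [hc, ← Finset.sum_sub_distrib, ← Finset.sum_add_distrib]
      exact Finset.sum_congr rfl fun i _ => by ring
    rw [this, ht]; field_simp; ring
  have hcs := Finset.sum_mul_sq_le_sq_mul_sq Finset.univ (fun i => 1 - t * ς i) x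
  rw [← hs, hn] at hcs
  have hxx : ∑ i, x i ^ 2 = x ⬝ᵥ x := by simp [dotProduct, sq]
  rw [hxx] at hcs
  refine hcs.trans_lt (mul_lt_mul_of_pos_right ?_ hq)
  have : 1 < P1 ^ 2 / P2 := (one_lt_div hP2pos).mpr hlt
  linarith

/-- for every positive vector `ς` and every nonzero `x` with
`ςᵀ x = 0`, one has `xᵀ L̄ x > (λ₂(L̄)/N) xᵀ x`, where `L̄ = R L + Lᵀ R`. -/
theorem quadratic_form_Lbar_lower_bound
    {N : ℕ} (hN : 2 ≤ N) (A : Matrix (Fin N) (Fin N) ℝ)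
    (hA : IsAdjacencyMatrix A) (hSC : IsStronglyConnected A)
    (ξ : Fin N → ℝ) (hpos : ∀ i, 0 < ξ i) (hsum : ∑ i, ξ i = 1)
    (hleft : ξ ᵥ* laplacian A = 0)
    (Lbar : Matrix (Fin N) (Fin N) ℝ)
    (hLbar : Lbar = Matrix.diagonal ξ * laplacian A + (laplacian A)ᵀ * Matrix.diagonal ξ)
    (hHerm : Lbar.IsHermitian)
    (ς x : Fin N → ℝ) (hς : ∀ i, 0 < ς i) (hortho : ς ⬝ᵥ x = 0) (hx : x ≠ 0) :
    (secondSmallestEigenvalue hN hHerm / N) * (x ⬝ᵥ x) < x ⬝ᵥ Lbar.mulVec x := by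
  have hQ : ∀ z : Fin N → ℝ, z ⬝ᵥ Lbar *ᵥ z = ∑ i, ∑ j, ξ i * A i j * (z i - z j) ^ 2 := by
    intro z; rw [hLbar]; exact aux_quad A hA ξ hleft z
  set u : Fin N → Fin N → ℝ := fun i => (hHerm.eigenvectorBasis i).ofLp with hu
  set ev := hHerm.eigenvalues with hev
  set σ := Tuple.sort ev with hσ
  have hmono : Monotone (ev ∘ σ) := Tuple.monotone_sort ev
  set i0 : Fin N := σ ⟨0, by omega⟩ with hi0
  set i1 : Fin N := σ ⟨1, by omega⟩ with hi1
  have hl2 : secondSmallestEigenvalue hN hHerm = ev i1 := rfl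
  rw [hl2]
  have h01 : ev i0 ≤ ev i1 := hmono (show (⟨0, by omega⟩ : Fin N) ≤ ⟨1, by omega⟩ by simp)
  have hne01 : i0 ≠ i1 := by
    intro h; have := σ.injective h; simp at this
  have hge : ∀ i, i ≠ i0 → ev i1 ≤ ev i := by
    intro i hi
    obtain ⟨k, rfl⟩ := σ.surjective i
    refine hmono (a := ⟨1, by omega⟩) (b := k) ?_
    have hk : k ≠ ⟨0, by omega⟩ := fun h => hi (by rw [h])
    rw [Fin.le_def]
    have : k.val ≠ 0 := fun h => hk (Fin.ext h)
    show 1 ≤ k.val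
    omega
  have horth : ∀ i j, u i ⬝ᵥ u j = if i = j then 1 else 0 := aux_orth hHerm
  have hquad : ∀ i, u i ⬝ᵥ Lbar *ᵥ u i = ev i := by
    intro i
    rw [hHerm.mulVec_eigenvectorBasis, dotProduct_smul, horth]; simp [hev]
  have hc : ∀ i, ev i ≤ 0 → ∀ a b, u i a = u i b := by
    intro i hi
    refine aux_const A hA hSC ξ hpos (u i) ?_
    rw [← hQ, hquad]; exact hi
  have hlpos : 0 < ev i1 := by
    by_contra hcon
    push Not at hcon
    have c1 := hc i1 hcon
    have c0 := hc i0 (h01.trans hcon)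
    let z : Fin N := ⟨0, by omega⟩
    have e0 : ∀ a, u i0 a = u i0 z := fun a => c0 a z
    have e1 : ∀ a, u i1 a = u i1 z := fun a => c1 a z
    have o00 := horth i0 i0
    have o11 := horth i1 i1
    have o01 := horth i0 i1
    simp only [dotProduct, e0, e1, hne01, if_true, if_false, Finset.sum_const, Finset.card_univ,
      Fintype.card_fin, nsmul_eq_mul] at o00 o11 o01
    have : (N * (u i0 z * u i0 z)) * (N * (u i1 z * u i1 z))
        = (N * (u i0 z * u i1 z) : ℝ) ^ 2 := by ring
    rw [o00, o11, o01] at this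
    norm_num at this
  set one : Fin N → ℝ := fun _ => 1 with hone
  have hspec : ∀ z, z ⬝ᵥ Lbar *ᵥ z = ∑ i, ev i * (u i ⬝ᵥ z) ^ 2 := aux_spec hHerm
  have hevnn : ∀ i, 0 ≤ ev i := by
    intro i
    rw [← hquad, hQ]
    exact Finset.sum_nonneg fun i _ => Finset.sum_nonneg fun j _ =>
      mul_nonneg (mul_nonneg (hpos i).le (hA.2 i j)) (sq_nonneg _)
  have hperp : ∀ i, i ≠ i0 → u i ⬝ᵥ one = 0 := by
    have h := hspec one
    rw [hQ] at h
    simp only [hone, sub_self, ne_eq, OfNat.ofNat_ne_zero, not_false_eq_true, zero_pow, mul_zero,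
      Finset.sum_const_zero] at h
    have h' := (Finset.sum_eq_zero_iff_of_nonneg
      (fun i _ => mul_nonneg (hevnn i) (sq_nonneg _))).mp h.symm
    intro i hi
    have h2 := (mul_eq_zero.mp (h' i (Finset.mem_univ _))).resolve_left
      (hlpos.trans_le (hge i hi)).ne'
    exact (pow_eq_zero_iff two_ne_zero).mp h2
  have hpars : ∀ a b : Fin N → ℝ, ∑ i, (a ⬝ᵥ u i) * (u i ⬝ᵥ b) = a ⬝ᵥ b := aux_pars hHerm
  have hone1 : ∀ b, (u i0 ⬝ᵥ one) * (u i0 ⬝ᵥ b) = one ⬝ᵥ b := by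
    intro b
    rw [← hpars one b, Finset.sum_eq_single i0]
    · rw [dotProduct_comm one]
    · intro i _ hi; rw [dotProduct_comm one, hperp i hi, zero_mul]
    · simp
  have hNN : (u i0 ⬝ᵥ one) ^ 2 = N := by
    rw [sq, hone1]; simp [hone, dotProduct]
  have hs : (u i0 ⬝ᵥ one) * (u i0 ⬝ᵥ x) = ∑ i, x i := by
    rw [hone1]; simp [hone, dotProduct]
  have hcs := aux_cs hN ς x hς hortho hx
  rw [← hs, mul_pow, hNN] at hcs
  have hlow : ev i1 * (x ⬝ᵥ x - (u i0 ⬝ᵥ x) ^ 2) ≤ x ⬝ᵥ Lbar *ᵥ x := by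
    rw [hspec, ← hpars x x, ← Finset.add_sum_erase _ _ (Finset.mem_univ i0),
      ← Finset.add_sum_erase (Finset.univ) (fun i => ev i * (u i ⬝ᵥ x) ^ 2) (Finset.mem_univ i0),
      dotProduct_comm x (u i0), sq, add_sub_cancel_left, Finset.mul_sum]
    have : ∑ i ∈ Finset.univ.erase i0, ev i1 * (x ⬝ᵥ u i * u i ⬝ᵥ x)
        ≤ ∑ i ∈ Finset.univ.erase i0, ev i * (u i ⬝ᵥ x) ^ 2 := by
      refine Finset.sum_le_sum fun i hi => ?_
      rw [dotProduct_comm x, ← sq]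
      exact mul_le_mul_of_nonneg_right (hge i (Finset.ne_of_mem_erase hi)) (sq_nonneg _)
    have h0 := mul_nonneg (hevnn i0) (mul_self_nonneg (u i0 ⬝ᵥ x))
    linarith
  refine lt_of_lt_of_le ?_ hlow
  rw [div_mul_eq_mul_div, mul_div_assoc]
  refine mul_lt_mul_of_pos_left ?_ hlpos
  have hNpos : (0 : ℝ) < N := by exact_mod_cast (by omega : 0 < N)
  rw [div_lt_iff₀ hNpos]
  linarith
end

section
/- Let L be the Laplacian matrix of a strongly connected weighted digraph on N nodes, regarded as a matrix over ℂ. Then 0 is an algebraically simple eigenvalue of L (its algebraic multiplicity as a root of the characteristic polynomial is 1), and every nonzero eigenvalue of L has strictly positive real part. -/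
open Matrix Polynomial

lemma lap_mulVec {N : ℕ} (A : Matrix (Fin N) (Fin N) ℝ) (hA : IsAdjacencyMatrix A)
    (v : Fin N → ℂ) (i : Fin N) :
    (((laplacian A).map (Complex.ofReal)) *ᵥ v) i = ∑ k, (A i k : ℂ) * (v i - v k) := by
  have h : ∀ k, ((laplacian A).map (Complex.ofReal)) i k * v k
      = (if i = k then (∑ l, (A i l : ℂ)) * v i else 0) - (A i k : ℂ) * v k := by
    intro k
    by_cases hk : i = k
    · subst hk
      simp [laplacian, hA.1 i]
    · simp [laplacian, hk]
  simp only [Matrix.mulVec, dotProduct, h, Finset.sum_sub_distrib, mul_sub, Finset.sum_mul]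
  simp

lemma real_const {N : ℕ} (hN : 2 ≤ N) (A : Matrix (Fin N) (Fin N) ℝ)
    (hA : IsAdjacencyMatrix A) (hSC : IsStronglyConnected A) (v : Fin N → ℝ) (c : ℝ)
    (h : ∀ i, ∑ k, A i k * (v i - v k) = c) : ∃ M, ∀ i, v i = M := by
  have : Nonempty (Fin N) := ⟨⟨0, by omega⟩⟩
  obtain ⟨p, hp⟩ := Finite.exists_max v
  obtain ⟨q, hq⟩ := Finite.exists_min v
  have h1 : 0 ≤ c := by
    rw [← h p]
    exact Finset.sum_nonneg fun k _ => mul_nonneg (hA.2 _ _) (sub_nonneg.2 (hp k))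
  have h2 : c ≤ 0 := by
    rw [← h q]
    exact Finset.sum_nonpos fun k _ =>
      mul_nonpos_of_nonneg_of_nonpos (hA.2 _ _) (sub_nonpos.2 (hq k))
  have hc : c = 0 := le_antisymm h2 h1
  have key : ∀ i k, v i = v p → 0 < A i k → v k = v p := by
    intro i k hi hik
    have h3 := h i
    rw [hc, Finset.sum_eq_zero_iff_of_nonneg (fun k _ =>
      mul_nonneg (hA.2 _ _) (sub_nonneg.2 (by rw [hi]; exact hp k)))] at h3
    rcases mul_eq_zero.1 (h3 k (Finset.mem_univ _)) with h4 | h4 <;> linarith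
  refine ⟨v p, fun j => ?_⟩
  by_cases hj : j = p
  · rw [hj]
  obtain ⟨m, k, h0, hl, hk⟩ := hSC j p hj
  have : ∀ t, v (k t) = v p := by
    intro t
    induction t using Fin.reverseInduction with
    | last => rw [hl]
    | cast t ih => exact key _ _ ih (hk t)
  rw [← h0]; exact this 0

lemma complex_const {N : ℕ} (hN : 2 ≤ N) (A : Matrix (Fin N) (Fin N) ℝ)
    (hA : IsAdjacencyMatrix A) (hSC : IsStronglyConnected A) (v : Fin N → ℂ) (c : ℂ)
    (h : ∀ i, (((laplacian A).map (Complex.ofReal)) *ᵥ v) i = c) : ∃ M, ∀ i, v i = M := by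
  simp only [lap_mulVec A hA] at h
  obtain ⟨a, ha⟩ := real_const hN A hA hSC (fun i => (v i).re) c.re (fun i => by
    rw [← h i]; simp)
  obtain ⟨b, hb⟩ := real_const hN A hA hSC (fun i => (v i).im) c.im (fun i => by
    rw [← h i]; simp)
  exact ⟨⟨a, b⟩, fun i => Complex.ext (ha i) (hb i)⟩

/-- as a matrix over ℂ, the Laplacian of a strongly connected
weighted digraph has `0` as an algebraically simple eigenvalue (its
multiplicity as a root of the characteristic polynomial is `1`), and every
nonzero eigenvalue has strictly positive real part. -/
theorem laplacian_zero_simple_eigenvalue_and_spectrum_in_open_right_halfplane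
    {N : ℕ} (hN : 2 ≤ N) (A : Matrix (Fin N) (Fin N) ℝ)
    (hA : IsAdjacencyMatrix A) (hSC : IsStronglyConnected A) :
    (((laplacian A).map (Complex.ofReal)).charpoly).rootMultiplicity 0 = 1 ∧
    ∀ μ : ℂ, μ ≠ 0 → (((laplacian A).map (Complex.ofReal)).charpoly).IsRoot μ →
      0 < μ.re := by
  have hcp : ((laplacian A).map (Complex.ofReal)).charpoly
      = (Matrix.toLin' ((laplacian A).map (Complex.ofReal))).charpoly := by
    rw [Matrix.charpoly_toLin']
  constructor
  · have : Nonempty (Fin N) := ⟨⟨0, by omega⟩⟩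
    rw [hcp, ← LinearMap.finrank_maxGenEigenspace_eq]
    have hspan : Module.End.maxGenEigenspace (Matrix.toLin' ((laplacian A).map (Complex.ofReal))) 0
        = Submodule.span ℂ {(1 : Fin N → ℂ)} := by
      ext v
      rw [Module.End.mem_maxGenEigenspace, Submodule.mem_span_singleton]
      simp only [zero_smul, sub_zero]
      constructor
      · rintro ⟨k, hk⟩
        have : ∀ (k : ℕ) (v : Fin N → ℂ),
            ((Matrix.toLin' ((laplacian A).map (Complex.ofReal))) ^ k) v = 0 →
            ∃ M, ∀ i, v i = M := by
          intro k
          induction k with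
          | zero => intro v hv; exact ⟨0, fun i => by simpa using congrFun hv i⟩
          | succ k ih =>
            intro v hv
            rw [pow_succ, Module.End.mul_apply] at hv
            obtain ⟨c, hc⟩ := ih _ hv
            exact complex_const hN A hA hSC v c hc
        obtain ⟨M, hM⟩ := this k v hk
        exact ⟨M, by ext i; simp [hM i]⟩
      · rintro ⟨a, rfl⟩
        refine ⟨1, ?_⟩
        ext i
        rw [pow_one, Matrix.toLin'_apply, lap_mulVec A hA]
        simp
    rw [hspan, finrank_span_singleton one_ne_zero]
  · intro μ hμ hr
    rw [hcp, ← Module.End.hasEigenvalue_iff_isRoot_charpoly] at hr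
    obtain ⟨i, hi⟩ := eigenvalue_mem_ball hr
    by_contra hneg
    push Not at hneg
    apply hμ
    have hd : ((laplacian A).map (Complex.ofReal)) i i = ((∑ k, A i k : ℝ) : ℂ) := by
      simp [laplacian]
    have hs : ∑ j ∈ Finset.univ.erase i, ‖((laplacian A).map (Complex.ofReal)) i j‖
        = ∑ k, A i k := by
      rw [← Finset.add_sum_erase _ (fun k => A i k) (Finset.mem_univ i)]
      simp only [hA.1 i, zero_add]
      refine Finset.sum_congr rfl fun j hj => ?_
      have : i ≠ j := (Finset.ne_of_mem_erase hj).symm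
      simp [laplacian, this, abs_of_nonneg (hA.2 i j)]
    rw [hd, hs, Metric.mem_closedBall, dist_eq_norm] at hi
    have hd0 : 0 ≤ ∑ k, A i k := Finset.sum_nonneg fun k _ => hA.2 i k
    generalize ∑ k, A i k = d at hi hd0
    have h2 : ‖μ - (d : ℂ)‖ ^ 2 ≤ d ^ 2 := pow_le_pow_left₀ (norm_nonneg _) hi 2
    rw [← Complex.normSq_eq_norm_sq, Complex.normSq_apply] at h2
    simp at h2
    have h3 : 0 ≤ d * (-μ.re) := mul_nonneg hd0 (by linarith)
    apply Complex.ext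
    · simp only [Complex.zero_re]; nlinarith [sq_nonneg μ.re, sq_nonneg μ.im]
    · simp only [Complex.zero_im]; nlinarith [sq_nonneg μ.re, sq_nonneg μ.im]
end

section
/- Let L be the Laplacian matrix of a strongly connected weighted digraph on N nodes, let ξ be the positive left eigenvector of L associated with eigenvalue 0 normalized so that ∑_i ξ_i = 1, and let R = diag(ξ_1, …, ξ_N). Then the symmetric matrix L̄ = RL + LᵀR is positive semidefinite, and xᵀL̄x = 0 holds if and only if x = c·𝟙_N for some scalar c. -/
open Matrix

theorem quad_aux {N : ℕ} (A : Matrix (Fin N) (Fin N) ℝ)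
    (hA : IsAdjacencyMatrix A) (ξ : Fin N → ℝ) 
    (hleft : ξ ᵥ* laplacian A = 0) (x : Fin N → ℝ) :
    x ⬝ᵥ (Matrix.diagonal ξ * laplacian A + (laplacian A)ᵀ * Matrix.diagonal ξ).mulVec x
      = ∑ i, ∑ j, ξ i * A i j * (x i - x j) ^ 2 := by
  have hL : laplacian A = Matrix.diagonal (fun i => ∑ k, A i k) - A := by
    ext i j
    by_cases h : i = j
    · subst h; simp [laplacian, hA.1]
    · simp [laplacian, h]
  have hcol : ∀ j, ξ j * ∑ k, A j k = ∑ i, ξ i * A i j := by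
    intro j
    have h := congrFun hleft j
    rw [hL, Matrix.vecMul_sub] at h
    simp only [Pi.sub_apply, Matrix.vecMul_diagonal, Pi.zero_apply] at h
    have h2 : (ξ ᵥ* A) j = ∑ i, ξ i * A i j := rfl
    linarith
  have hLx : ∀ i, (laplacian A *ᵥ x) i = ∑ j, A i j * (x i - x j) := by
    intro i
    rw [hL, Matrix.sub_mulVec]
    simp only [Pi.sub_apply, Matrix.mulVec_diagonal]
    have h2 : (A *ᵥ x) i = ∑ j, A i j * x j := rfl
    rw [h2, Finset.sum_mul, ← Finset.sum_sub_distrib]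
    exact Finset.sum_congr rfl fun j _ => by ring
  have h1 : x ⬝ᵥ ((Matrix.diagonal ξ * laplacian A) *ᵥ x)
      = ∑ i, ∑ j, ξ i * A i j * (x i * (x i - x j)) := by
    rw [← Matrix.mulVec_mulVec]
    simp only [dotProduct, Matrix.mulVec_diagonal, hLx, Finset.mul_sum]
    exact Finset.sum_congr rfl fun i _ => Finset.sum_congr rfl fun j _ => by ring
  have h2 : x ⬝ᵥ (((laplacian A)ᵀ * Matrix.diagonal ξ) *ᵥ x)
      = x ⬝ᵥ ((Matrix.diagonal ξ * laplacian A) *ᵥ x) := by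
    have : (laplacian A)ᵀ * Matrix.diagonal ξ = (Matrix.diagonal ξ * laplacian A)ᵀ := by
      rw [Matrix.transpose_mul, Matrix.diagonal_transpose]
    rw [this, Matrix.mulVec_transpose, dotProduct_comm, ← Matrix.dotProduct_mulVec]
  have h3 : ∑ i, ∑ j, ξ i * A i j * x j ^ 2 = ∑ i, ∑ j, ξ i * A i j * x i ^ 2 := by
    rw [Finset.sum_comm]
    refine Finset.sum_congr rfl fun j _ => ?_
    rw [← Finset.sum_mul, ← hcol, ← Finset.sum_mul, Finset.mul_sum]
  rw [Matrix.add_mulVec, dotProduct_add, h2, h1]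
  have h4 : ∑ i, ∑ j, ξ i * A i j * (x i - x j) ^ 2
      = ∑ i, ∑ j, ξ i * A i j * (x i * (x i - x j)) + ∑ i, ∑ j, ξ i * A i j * (x i * (x i - x j))
        + (∑ i, ∑ j, ξ i * A i j * x j ^ 2 - ∑ i, ∑ j, ξ i * A i j * x i ^ 2) := by
    simp only [← Finset.sum_add_distrib, ← Finset.sum_sub_distrib]
    exact Finset.sum_congr rfl fun i _ => Finset.sum_congr rfl fun j _ => by ring
  rw [h4, h3]; ring

/-- `L̄ = R L + Lᵀ R` is positive semidefinite and its quadratic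
form vanishes exactly on constant vectors. -/
theorem Lbar_posSemidef_and_kernel_of_quadratic_form
    {N : ℕ} (hN : 2 ≤ N) (A : Matrix (Fin N) (Fin N) ℝ)
    (hA : IsAdjacencyMatrix A) (hSC : IsStronglyConnected A)
    (ξ : Fin N → ℝ) (hpos : ∀ i, 0 < ξ i) (hsum : ∑ i, ξ i = 1)
    (hleft : ξ ᵥ* laplacian A = 0)
    (Lbar : Matrix (Fin N) (Fin N) ℝ)
    (hLbar : Lbar = Matrix.diagonal ξ * laplacian A + (laplacian A)ᵀ * Matrix.diagonal ξ) :
    Lbar.PosSemidef ∧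
    ∀ x : Fin N → ℝ, x ⬝ᵥ Lbar.mulVec x = 0 ↔ ∃ c : ℝ, x = fun _ => c := by
  subst hLbar
  have hnn : ∀ (x : Fin N → ℝ) (i j : Fin N), 0 ≤ ξ i * A i j * (x i - x j) ^ 2 :=
    fun x i j => mul_nonneg (mul_nonneg (hpos i).le (hA.2 i j)) (sq_nonneg _)
  refine ⟨Matrix.PosSemidef.of_dotProduct_mulVec_nonneg ?_ ?_, ?_⟩
  · ext i j
    simp [Matrix.diagonal_mul, Matrix.mul_diagonal]
    ring
  · intro x
    rw [star_trivial, quad_aux A hA ξ hleft]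
    exact Finset.sum_nonneg fun i _ => Finset.sum_nonneg fun j _ => hnn x i j
  · intro x
    rw [quad_aux A hA ξ hleft]
    constructor
    · intro h
      have hz : ∀ i j, ξ i * A i j * (x i - x j) ^ 2 = 0 := by
        intro i j
        have h1 := (Finset.sum_eq_zero_iff_of_nonneg
          (fun i _ => Finset.sum_nonneg fun j _ => hnn x i j)).1 h i (Finset.mem_univ i)
        exact (Finset.sum_eq_zero_iff_of_nonneg (fun j _ => hnn x i j)).1 h1 j (Finset.mem_univ j)
      have hedge : ∀ i j, 0 < A i j → x i = x j := by
        intro i j hij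
        have h1 := hz i j
        have h2 : ξ i * A i j ≠ 0 := (mul_pos (hpos i) hij).ne'
        have h3 := pow_eq_zero_iff (two_ne_zero) |>.1 ((mul_eq_zero.1 h1).resolve_left h2)
        linarith
      let j0 : Fin N := ⟨0, by omega⟩
      refine ⟨x j0, funext fun i => ?_⟩
      by_cases hi : j0 = i
      · rw [hi]
      obtain ⟨m, k, hk0, hkm, hk⟩ := hSC j0 i hi
      have hall : ∀ t : Fin (m + 1), x (k t) = x j0 := by
        intro t
        induction t using Fin.induction with
        | zero => rw [hk0]
        | succ t ih => rw [hedge _ _ (hk t), ih]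
      rw [← hkm]; exact hall _
    · rintro ⟨c, rfl⟩
      simp
end

section
/- Let L be the Laplacian matrix of a strongly connected weighted digraph on N nodes, and let ξ be the positive left eigenvector of L associated with eigenvalue 0 normalized so that ∑_i ξ_i = 1. Let w : [0, ∞) → ℝ^{N·N} be a differentiable function satisfying ẇ(t) = −(L ⊗ I_N) w(t) for all t ≥ 0, where w = col(w_1, …, w_N) with each w_i(t) ∈ ℝ^N, and with initial condition w_i^i(0) = 1 and w_i^k(0) = 0 for all k ≠ i (w_i^k denotes the k-th component of w_i). Then for every i and every t ≥ 0, one has w_i^i(t) > 0. -/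
open Matrix

lemma laplacian_sum_aux {N : ℕ} (A : Matrix (Fin N) (Fin N) ℝ) (hA : IsAdjacencyMatrix A)
    (y : Fin N → ℝ) (i : Fin N) :
    ∑ j, laplacian A i j * y j = ∑ j, A i j * (y i - y j) := by
  have h : ∀ j, laplacian A i j * y j = (if i = j then (∑ k, A i k) * y j else 0) - A i j * y j := by
    intro j
    by_cases hij : i = j
    · subst hij
      simp [laplacian, hA.1]
    · simp [laplacian, hij]
  simp only [h, mul_sub, Finset.sum_sub_distrib, Finset.sum_ite_eq, Finset.mem_univ, if_true,
    Finset.sum_mul]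

lemma hasDerivAt_min_sq_aux (y : ℝ) :
    HasDerivAt (fun s : ℝ => (min s 0) ^ 2) (2 * min y 0) y := by
  rcases lt_trichotomy y 0 with h | h | h
  · have h1 : HasDerivAt (fun s : ℝ => s ^ 2) (2 * y) y := by
      simpa using hasDerivAt_pow 2 y
    rw [min_eq_left h.le]
    refine h1.congr_of_eventuallyEq ?_
    filter_upwards [Iio_mem_nhds h] with s hs
    rw [min_eq_left (le_of_lt hs)]
  · subst h
    have h1 : HasDerivAt (fun s : ℝ => s ^ 2) 0 0 := by
      simpa using hasDerivAt_pow 2 (0 : ℝ)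
    rw [hasDerivAt_iff_isLittleO] at h1 ⊢
    simp only [min_self, mul_zero, smul_zero, sub_zero] at h1 ⊢
    norm_num at h1 ⊢
    refine Asymptotics.IsBigO.trans_isLittleO ?_ h1
    refine Asymptotics.IsBigO.of_bound 1 (Filter.Eventually.of_forall fun s => ?_)
    rw [one_mul, Real.norm_of_nonneg (by positivity), Real.norm_of_nonneg (by positivity)]
    rcases le_total s 0 with hs | hs
    · simp [hs]
    · simp [hs]
  · rw [min_eq_right h.le, mul_zero]
    refine (hasDerivAt_const y (0 : ℝ)).congr_of_eventuallyEq ?_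
    filter_upwards [Ioi_mem_nhds h] with s hs
    rw [min_eq_right (le_of_lt hs)]; norm_num

lemma flow_nonneg_aux {N : ℕ} (A : Matrix (Fin N) (Fin N) ℝ)
    (hA : IsAdjacencyMatrix A)
    (ξ : Fin N → ℝ) (hpos : ∀ i, 0 < ξ i)
    (hleft : ξ ᵥ* laplacian A = 0) (x : ℝ → Fin N → ℝ)
    (hx : ∀ t : ℝ, 0 ≤ t → ∀ i, HasDerivAt (fun s => x s i) (-(∑ j, A i j * (x t i - x t j))) t)
    (h0 : ∀ i, 0 ≤ x 0 i) (t : ℝ) (ht : 0 ≤ t) (i : Fin N) : 0 ≤ x t i := by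
  let V : ℝ → ℝ := fun s => ∑ i, ξ i * (min (x s i) 0) ^ 2
  have hV : ∀ s, 0 ≤ s → HasDerivAt V
      (∑ i, ξ i * (2 * min (x s i) 0 * (-(∑ j, A i j * (x s i - x s j))))) s := by
    intro s hs
    refine HasDerivAt.fun_sum fun i _ => ?_
    exact ((hasDerivAt_min_sq_aux (x s i)).comp s (hx s hs i)).const_mul (ξ i)
  have hanti : AntitoneOn V (Set.Ici 0) := by
    refine antitoneOn_of_deriv_nonpos (convex_Ici 0)
      (fun s hs => (hV s hs).continuousAt.continuousWithinAt)
      (fun s hs => (hV s (interior_subset hs)).differentiableAt.differentiableWithinAt) ?_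
    intro s hs
    rw [(hV s (interior_subset hs)).deriv]
    have key : ∑ i, ξ i * ∑ j, A i j * ((min (x s i) 0) ^ 2 - (min (x s j) 0) ^ 2) = 0 := by
      have h1 : ∀ i, ∑ j, A i j * ((min (x s i) 0) ^ 2 - (min (x s j) 0) ^ 2)
          = (laplacian A *ᵥ fun j => (min (x s j) 0) ^ 2) i := fun i =>
        (laplacian_sum_aux A hA (fun j => (min (x s j) 0) ^ 2) i).symm
      simp only [h1]
      change ξ ⬝ᵥ (laplacian A *ᵥ fun j => (min (x s j) 0) ^ 2) = 0
      rw [Matrix.dotProduct_mulVec, hleft, zero_dotProduct]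
    refine le_trans (b := -∑ i, ξ i * ∑ j, A i j * ((min (x s i) 0) ^ 2 - (min (x s j) 0) ^ 2))
      ?_ (by rw [key, neg_zero])
    rw [← Finset.sum_neg_distrib]
    refine Finset.sum_le_sum fun i _ => ?_
    rw [← mul_neg]
    refine mul_le_mul_of_nonneg_left ?_ (hpos i).le
    rw [mul_neg, neg_le_neg_iff, Finset.mul_sum]
    refine Finset.sum_le_sum fun j _ => ?_
    rw [mul_left_comm]
    refine mul_le_mul_of_nonneg_left ?_ (hA.2 i j)
    have e1 : min (x s i) 0 * x s i = (min (x s i) 0) ^ 2 := by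
      rcases le_total (x s i) 0 with h | h
      · simp [h, sq]
      · simp [h]
    have e2 : min (x s i) 0 * x s j ≤ min (x s i) 0 * min (x s j) 0 :=
      mul_le_mul_of_nonpos_left (min_le_left _ _) (min_le_right _ _)
    nlinarith [sq_nonneg (min (x s i) 0 - min (x s j) 0)]
  have hV0 : V 0 = 0 := by simp [V, h0]
  have hVt : V t ≤ 0 := hV0 ▸ hanti (Set.mem_Ici.2 le_rfl) (Set.mem_Ici.2 ht) ht
  by_contra hneg
  push Not at hneg
  have : ξ i * (min (x t i) 0) ^ 2 ≤ V t :=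
    Finset.single_le_sum (f := fun i => ξ i * (min (x t i) 0) ^ 2)
      (fun j _ => mul_nonneg (hpos j).le (sq_nonneg _)) (Finset.mem_univ i)
  rw [min_eq_left hneg.le] at this
  have := mul_pos (hpos i) (pow_pos (neg_pos.2 hneg) 2)
  nlinarith

/-- along the flow `ẇ = -(L ⊗ I_N) w` (written blockwise:
`d/dt w_i^k = -∑_j L_{ij} w_j^k`) with initial condition `w_i^i(0) = 1` and
`w_i^k(0) = 0` for `k ≠ i`, one has `w_i^i(t) > 0` for all `t ≥ 0`.
Here `w t i : Fin N → ℝ` is the block `w_i(t) ∈ ℝ^N` of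
`w = col(w_1, …, w_N) : ℝ^{N·N}`. -/
theorem diagonal_blocks_positive_along_laplacian_flow
    {N : ℕ} (hN : 2 ≤ N) (A : Matrix (Fin N) (Fin N) ℝ)
    (hA : IsAdjacencyMatrix A) (hSC : IsStronglyConnected A)
    (ξ : Fin N → ℝ) (hpos : ∀ i, 0 < ξ i) (hsum : ∑ i, ξ i = 1)
    (hleft : ξ ᵥ* laplacian A = 0)
    (w : ℝ → Fin N → Fin N → ℝ)
    (hode : ∀ t : ℝ, 0 ≤ t → ∀ i k : Fin N,
      HasDerivAt (fun s => w s i k) (-(∑ j, laplacian A i j * w t j k)) t)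
    (hinit_diag : ∀ i, w 0 i i = 1)
    (hinit_off : ∀ i k, k ≠ i → w 0 i k = 0) :
    ∀ i : Fin N, ∀ t : ℝ, 0 ≤ t → 0 < w t i i := by
  intro k t ht
  have hx : ∀ t : ℝ, 0 ≤ t → ∀ i, HasDerivAt (fun s => w s i k)
      (-(∑ j, A i j * (w t i k - w t j k))) t := by
    intro t ht i
    rw [← laplacian_sum_aux A hA (fun j => w t j k) i]
    exact hode t ht i k
  have hnn : ∀ t : ℝ, 0 ≤ t → ∀ i, 0 ≤ w t i k := by
    refine flow_nonneg_aux A hA ξ hpos hleft (fun s i => w s i k) hx ?_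
    intro i
    by_cases h : k = i
    · subst h; simp [hinit_diag]
    · simp [hinit_off i k h]
  set d : ℝ := ∑ j, A k j with hd
  have hD : ∀ s, 0 ≤ s → HasDerivAt (fun s => Real.exp (d * s) * w s k k)
      (Real.exp (d * s) * (∑ j, A k j * w s j k)) s := by
    intro s hs
    have h1 : HasDerivAt (fun s => Real.exp (d * s)) (Real.exp (d * s) * d) s := by
      simpa using ((hasDerivAt_id s).const_mul d).exp
    refine (h1.mul (hx s hs k)).congr_deriv ?_
    simp only [mul_sub, Finset.sum_sub_distrib, ← Finset.sum_mul, ← hd]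
    ring
  have hmono : MonotoneOn (fun s => Real.exp (d * s) * w s k k) (Set.Ici 0) := by
    refine monotoneOn_of_deriv_nonneg (convex_Ici 0)
      (fun s hs => (hD s hs).continuousAt.continuousWithinAt)
      (fun s hs => (hD s (interior_subset hs)).differentiableAt.differentiableWithinAt) ?_
    intro s hs
    rw [(hD s (interior_subset hs)).deriv]
    exact mul_nonneg (Real.exp_pos _).le (Finset.sum_nonneg fun j _ =>
      mul_nonneg (hA.2 k j) (hnn s (interior_subset hs) j))
  have := hmono (Set.mem_Ici.2 le_rfl) (Set.mem_Ici.2 ht) ht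
  simp only [mul_zero, Real.exp_zero, hinit_diag, mul_one] at this
  exact pos_of_mul_pos_right (lt_of_lt_of_le one_pos this) (Real.exp_pos _).le
end

section
/- Let L be the Laplacian matrix of a strongly connected weighted digraph on N nodes, let ξ be the positive left eigenvector of L associated with eigenvalue 0 normalized so that ∑_i ξ_i = 1, let R = diag(ξ_1, …, ξ_N), and let L̄ = RL + LᵀR. Let D ∈ ℝ^{N×N} be a positive diagonal matrix and n ≥ 1. Then for every y ∈ ℝ^{N·n}, the vector ζ = (L ⊗ I_n) y satisfies ζᵀ ((D L̄ D) ⊗ I_n) ζ ≥ (λ₂(L̄)/N) · ζᵀ ((D²) ⊗ I_n) ζ. -/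
open Matrix
open scoped Kronecker

lemma aux_kron {N n : ℕ} (M : Matrix (Fin N) (Fin N) ℝ) (z : Fin N × Fin n → ℝ) (i : Fin N)
    (k : Fin n) : (M ⊗ₖ (1 : Matrix (Fin n) (Fin n) ℝ)).mulVec z (i, k)
      = (M *ᵥ fun j => z (j, k)) i := by
  simp only [mulVec, dotProduct, Fintype.sum_prod_type, kroneckerMap_apply, one_apply]
  simp

lemma aux_kron_quad {N n : ℕ} (M : Matrix (Fin N) (Fin N) ℝ) (z : Fin N × Fin n → ℝ) :
    z ⬝ᵥ (M ⊗ₖ (1 : Matrix (Fin n) (Fin n) ℝ)).mulVec z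
      = ∑ k, (fun j => z (j, k)) ⬝ᵥ (M *ᵥ fun j => z (j, k)) := by
  rw [dotProduct, Fintype.sum_prod_type, Finset.sum_comm]
  simp only [aux_kron]
  rfl

lemma aux_lap {N : ℕ} (A : Matrix (Fin N) (Fin N) ℝ) (hA : IsAdjacencyMatrix A)
    (x : Fin N → ℝ) (i : Fin N) :
    (laplacian A *ᵥ x) i = ∑ j, A i j * (x i - x j) := by
  have h : ∀ j, laplacian A i j * x j = (if i = j then (∑ k, A i k) * x j else 0) - A i j * x j := by
    intro j
    by_cases hij : i = j
    · subst hij; simp [laplacian, hA.1]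
    · simp [laplacian, hij]
  simp only [mulVec, dotProduct, h, Finset.sum_sub_distrib, mul_sub]
  simp [Finset.sum_mul]

lemma aux_psd {N : ℕ} (A : Matrix (Fin N) (Fin N) ℝ) (hA : IsAdjacencyMatrix A)
    (ξ : Fin N → ℝ) (hpos : ∀ i, 0 < ξ i) (hleft : ξ ᵥ* laplacian A = 0) (x : Fin N → ℝ) :
    0 ≤ x ⬝ᵥ ((Matrix.diagonal ξ * laplacian A + (laplacian A)ᵀ * Matrix.diagonal ξ) *ᵥ x) := by
  have h1 : x ⬝ᵥ ((Matrix.diagonal ξ * laplacian A + (laplacian A)ᵀ * Matrix.diagonal ξ) *ᵥ x)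
      = 2 * ∑ i, ξ i * x i * (laplacian A *ᵥ x) i := by
    rw [add_mulVec, dotProduct_add, ← mulVec_mulVec, ← mulVec_mulVec, mulVec_transpose,
      dotProduct_comm x (_ ᵥ* _), ← dotProduct_mulVec, two_mul]
    simp only [dotProduct, mulVec_diagonal]
    congr 1
    exact Finset.sum_congr rfl fun i _ => by ring
  have h2 : ∑ i, ξ i * (laplacian A *ᵥ fun j => x j ^ 2) i = 0 := by
    have := dotProduct_mulVec ξ (laplacian A) (fun j => x j ^ 2)
    rw [hleft, zero_dotProduct] at this
    exact this
  have h3 : 2 * ∑ i, ξ i * x i * (laplacian A *ᵥ x) i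
      = ∑ i, ∑ j, ξ i * A i j * (x i - x j) ^ 2 := by
    rw [← sub_zero (2 * _), ← h2]
    simp only [aux_lap A hA, Finset.mul_sum, ← Finset.sum_sub_distrib]
    refine Finset.sum_congr rfl fun i _ => Finset.sum_congr rfl fun j _ => ?_
    ring
  rw [h1, h3]
  exact Finset.sum_nonneg fun i _ => Finset.sum_nonneg fun j _ =>
    mul_nonneg (mul_nonneg (hpos i).le (hA.2 i j)) (sq_nonneg _)

lemma aux_one {N : ℕ} (A : Matrix (Fin N) (Fin N) ℝ) (hA : IsAdjacencyMatrix A)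
    (ξ : Fin N → ℝ) (hleft : ξ ᵥ* laplacian A = 0) :
    (Matrix.diagonal ξ * laplacian A + (laplacian A)ᵀ * Matrix.diagonal ξ) *ᵥ (fun _ => 1) = 0 := by
  have h1 : laplacian A *ᵥ (fun _ => (1:ℝ)) = 0 := by
    ext i; simp [aux_lap A hA]
  have h2 : Matrix.diagonal ξ *ᵥ (fun _ => (1:ℝ)) = ξ := by
    ext i; simp [mulVec_diagonal]
  rw [add_mulVec, ← mulVec_mulVec, ← mulVec_mulVec, h1, h2, mulVec_transpose, hleft]
  simp

lemma aux_spec_s14 {N : ℕ} (hN : 2 ≤ N) (M : Matrix (Fin N) (Fin N) ℝ) (hM : M.IsHermitian)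
    (h1 : M *ᵥ (fun _ => 1) = 0) (hl : 0 < secondSmallestEigenvalue hN hM) (v : Fin N → ℝ) :
    secondSmallestEigenvalue hN hM * (v ⬝ᵥ v - (∑ i, v i) ^ 2 / N) ≤ v ⬝ᵥ (M *ᵥ v) := by
  set l := secondSmallestEigenvalue hN hM with hldef
  obtain ⟨i0, hi0⟩ : ∃ i0, ∀ i, i ≠ i0 → l ≤ hM.eigenvalues i := by
    refine ⟨Tuple.sort hM.eigenvalues ⟨0, by omega⟩, fun i hi => ?_⟩
    have hm := Tuple.monotone_sort hM.eigenvalues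
    obtain ⟨j, rfl⟩ := (Tuple.sort hM.eigenvalues).surjective i
    have hj : j ≠ ⟨0, by omega⟩ := fun h => hi (by rw [h])
    have : (⟨1, by omega⟩ : Fin N) ≤ j := by
      rw [Fin.le_def]
      have : j.val ≠ 0 := fun h => hj (Fin.ext h)
      simp only
      omega
    exact hm this
  let f : Fin N → Fin N → ℝ := fun i => ⇑(hM.eigenvectorBasis i)
  have pars : ∀ x y : Fin N → ℝ, ∑ i, (f i ⬝ᵥ x) * (f i ⬝ᵥ y) = x ⬝ᵥ y := by
    intro x y
    have := hM.eigenvectorBasis.sum_inner_mul_inner (WithLp.toLp 2 x) (WithLp.toLp 2 y)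
    simp only [EuclideanSpace.inner_eq_star_dotProduct] at this
    simp only [star_trivial] at this
    rw [dotProduct_comm x y, ← this]
    refine Finset.sum_congr rfl fun i _ => ?_
    rw [dotProduct_comm (f i) y]
  have eig : ∀ i x, f i ⬝ᵥ (M *ᵥ x) = hM.eigenvalues i * (f i ⬝ᵥ x) := by
    intro i x
    have h := hM.mulVec_eigenvectorBasis i
    have hT : Mᵀ = M := by rw [← conjTranspose_eq_transpose_of_trivial]; exact hM
    rw [dotProduct_mulVec, ← mulVec_transpose, hT]
    change (M *ᵥ (hM.eigenvectorBasis i).ofLp) ⬝ᵥ x = _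
    rw [h, smul_dotProduct, smul_eq_mul]
  have hz : ∀ i, i ≠ i0 → f i ⬝ᵥ (fun _ => 1) = 0 := by
    intro i hi
    have := eig i (fun _ => 1)
    rw [h1, dotProduct_zero] at this
    have h3 := hi0 i hi
    rcases mul_eq_zero.1 this.symm with h | h
    · linarith
    · exact h
  have p1 : ∀ x, (f i0 ⬝ᵥ (fun _ => 1)) * (f i0 ⬝ᵥ x) = ∑ i, x i := by
    intro x
    have := pars (fun _ => 1) x
    rw [Finset.sum_eq_single i0 (fun i _ hi => by rw [hz i hi, zero_mul]) (by simp)] at this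
    rw [this]; simp [dotProduct]
  have p2 := p1 (fun _ => 1)
  have p3 := p1 v
  simp only [Finset.sum_const, Finset.card_univ, Fintype.card_fin, nsmul_eq_mul, mul_one] at p2
  have hNpos : (0:ℝ) < N := by exact_mod_cast (by omega : 0 < N)
  have p4 : (∑ i, v i) ^ 2 / N = (f i0 ⬝ᵥ v) * (f i0 ⬝ᵥ v) := by
    rw [div_eq_iff hNpos.ne', ← p3, ← p2]; ring
  have p0 : hM.eigenvalues i0 = 0 := by
    have := eig i0 (fun _ => 1)
    rw [h1, dotProduct_zero] at this
    rcases mul_eq_zero.1 this.symm with h | h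
    · exact h
    · rw [h] at p2; linarith
  rw [p4, ← pars v v, ← pars v (M *ᵥ v), ← Finset.add_sum_erase _ _ (Finset.mem_univ i0),
    ← Finset.add_sum_erase _ (fun i => (f i ⬝ᵥ v) * (f i ⬝ᵥ (M *ᵥ v))) (Finset.mem_univ i0),
    eig i0, p0]
  simp only [zero_mul, mul_zero, zero_add, add_sub_cancel_left, Finset.mul_sum]
  refine Finset.sum_le_sum fun i hi => ?_
  rw [eig]
  nlinarith [hi0 i (Finset.ne_of_mem_erase hi), mul_self_nonneg (f i ⬝ᵥ v)]

lemma aux_cs' {N : ℕ} (v w : Fin N → ℝ) (hw : ∀ i, 0 < w i) (hN : 2 ≤ N)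
    (h : ∑ i, w i * v i = 0) (hs : 0 ≤ ∑ i, v i) :
    (∑ i, v i) ^ 2 ≤ (N - 1) * (v ⬝ᵥ v) := by
  obtain ⟨j, hj⟩ : ∃ j, v j ≤ 0 := by
    by_contra! hc
    have : 0 < ∑ i, w i * v i :=
      Finset.sum_pos (fun i _ => mul_pos (hw i) (hc i)) ⟨⟨0, by omega⟩, Finset.mem_univ _⟩
    linarith
  have e1 := Finset.add_sum_erase Finset.univ v (Finset.mem_univ j)
  have e2 := Finset.add_sum_erase Finset.univ (fun i => v i * v i) (Finset.mem_univ j)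
  have c := sq_sum_le_card_mul_sum_sq (s := Finset.univ.erase j) (f := v)
  rw [Finset.card_erase_of_mem (Finset.mem_univ j), Finset.card_univ, Fintype.card_fin,
    Nat.cast_sub (by omega), Nat.cast_one] at c
  have hN' : (2:ℝ) ≤ N := by exact_mod_cast hN
  simp only [pow_two (v _)] at c
  have c1 : (∑ i, v i) ^ 2 ≤ (∑ i ∈ Finset.univ.erase j, v i) ^ 2 :=
    pow_le_pow_left₀ hs (by linarith) 2
  have c2 : ∑ i ∈ Finset.univ.erase j, v i * v i ≤ v ⬝ᵥ v := by
    simp only [dotProduct]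
    nlinarith [mul_self_nonneg (v j)]
  nlinarith

lemma aux_cs_s14 {N : ℕ} (v w : Fin N → ℝ) (hw : ∀ i, 0 < w i) (hN : 2 ≤ N)
    (h : ∑ i, w i * v i = 0) :
    (∑ i, v i) ^ 2 ≤ (N - 1) * (v ⬝ᵥ v) := by
  rcases le_total 0 (∑ i, v i) with hs | hs
  · exact aux_cs' v w hw hN h hs
  · have := aux_cs' (-v) w hw hN (by simp [h]) (by simpa using hs)
    simpa using this

/-- for any positive diagonal `D` and any `y`, the vector
`ζ = (L ⊗ I_n) y` satisfies
`ζᵀ (D L̄ D ⊗ I_n) ζ ≥ (λ₂(L̄)/N) ζᵀ (D² ⊗ I_n) ζ`. -/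
theorem kron_quadratic_form_Lbar_bound
    {N n : ℕ} (hN : 2 ≤ N) (hn : 1 ≤ n) (A : Matrix (Fin N) (Fin N) ℝ)
    (hA : IsAdjacencyMatrix A) (hSC : IsStronglyConnected A)
    (ξ : Fin N → ℝ) (hpos : ∀ i, 0 < ξ i) (hsum : ∑ i, ξ i = 1)
    (hleft : ξ ᵥ* laplacian A = 0)
    (Lbar : Matrix (Fin N) (Fin N) ℝ)
    (hLbar : Lbar = Matrix.diagonal ξ * laplacian A + (laplacian A)ᵀ * Matrix.diagonal ξ)
    (hHerm : Lbar.IsHermitian)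
    (d : Fin N → ℝ) (hd : ∀ i, 0 < d i)
    (y : Fin N × Fin n → ℝ) :
    ∀ ζ : Fin N × Fin n → ℝ,
      ζ = ((laplacian A) ⊗ₖ (1 : Matrix (Fin n) (Fin n) ℝ)).mulVec y →
      (secondSmallestEigenvalue hN hHerm / N) *
          (ζ ⬝ᵥ ((Matrix.diagonal d * Matrix.diagonal d) ⊗ₖ
            (1 : Matrix (Fin n) (Fin n) ℝ)).mulVec ζ) ≤
        ζ ⬝ᵥ ((Matrix.diagonal d * Lbar * Matrix.diagonal d) ⊗ₖ
            (1 : Matrix (Fin n) (Fin n) ℝ)).mulVec ζ := by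
  intro ζ hζ
  rw [aux_kron_quad, aux_kron_quad, Finset.mul_sum]
  refine Finset.sum_le_sum fun k _ => ?_
  set z : Fin N → ℝ := fun j => ζ (j, k) with hz
  have hzL : z = laplacian A *ᵥ fun j => y (j, k) := by
    ext i; rw [hz, hζ]; exact aux_kron _ _ _ _
  have hxz : ξ ⬝ᵥ z = 0 := by
    rw [hzL, dotProduct_mulVec, hleft, zero_dotProduct]
  set v : Fin N → ℝ := Matrix.diagonal d *ᵥ z with hv
  have hvi : ∀ i, v i = d i * z i := fun i => by simp [hv, mulVec_diagonal]
  have hq : ∀ x, z ⬝ᵥ (Matrix.diagonal d *ᵥ x) = v ⬝ᵥ x := by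
    intro x
    simp only [dotProduct, mulVec_diagonal, hvi]
    exact Finset.sum_congr rfl fun i _ => by ring
  rw [← mulVec_mulVec, ← mulVec_mulVec, ← mulVec_mulVec, hq, hq, ← hv]
  have hNpos : (0:ℝ) < N := by exact_mod_cast (by omega : 0 < N)
  have hvv : 0 ≤ v ⬝ᵥ v := Finset.sum_nonneg fun i _ => mul_self_nonneg (v i)
  have hcs := aux_cs_s14 v (fun i => ξ i / d i) (fun i => div_pos (hpos i) (hd i)) hN (by
    rw [← hxz]
    refine Finset.sum_congr rfl fun i _ => ?_
    rw [hvi]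
    have := (hd i).ne'
    field_simp)
  rcases le_or_gt (secondSmallestEigenvalue hN hHerm) 0 with hl | hl
  · have hp := aux_psd A hA ξ hpos hleft v
    rw [← hLbar] at hp
    exact le_trans (mul_nonpos_of_nonpos_of_nonneg
      (div_nonpos_of_nonpos_of_nonneg hl hNpos.le) hvv) hp
  · refine le_trans ?_ (aux_spec_s14 hN Lbar hHerm (by rw [hLbar]; exact aux_one A hA ξ hleft) hl v)
    rw [div_mul_eq_mul_div, mul_div_assoc]
    refine mul_le_mul_of_nonneg_left ?_ hl.le
    rw [div_le_iff₀ hNpos, sub_mul, div_mul_cancel₀ _ hNpos.ne']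
    linarith
end
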